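/- Let p_n be the minimum over all graphs G' in the family G_n (graphs obtained from K_{n-1,n+1} by adding a 2-factor inside the part of size n+1) of the probability that a uniformly random induced subgraph G'[S] (each vertex included independently with probability 1/2) is Hamiltonian. Then p_n = 1/2 + (3/2)/sqrt(n*pi) + O(n^{-3/2}). -/

import Mathlib

open Real

/-- The probability that a uniformly random induced subgraph of `G` (each vertex kept
independently with probability `1/2`) is Hamiltonian. -/
noncomputable def hamProb (n : ℕ) (G : SimpleGraph (Fin (2 * n))) : ℝ :=
  (Nat.card {S : Finset (Fin (2 * n)) //
      (G.induce (↑S : Set (Fin (2 * n)))).IsHamiltonian} : ℝ) / 2 ^ (2 * n)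

/-- `G` belongs to the family `𝒢ₙ`: it is obtained from the complete bipartite graph
`K_{n-1,n+1}` by adding a 2-factor inside the part of size `n+1`. -/
def InExtremalFamily (n : ℕ) (G : SimpleGraph (Fin (2 * n))) : Prop :=
  ∃ A : Finset (Fin (2 * n)), A.card = n + 1 ∧
    (∀ a ∈ A, ∀ b ∈ Aᶜ, G.Adj a b) ∧
    (∀ u ∈ Aᶜ, ∀ v ∈ Aᶜ, ¬ G.Adj u v) ∧
    (∀ a ∈ A, {b : Fin (2 * n) | b ∈ A ∧ G.Adj a b}.ncard = 2)

namespace SimpleGraph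
theorem isHamiltonian_of_list {V : Type*} [Fintype V] [DecidableEq V] {G : SimpleGraph V}
    (l : List V) (hl : l.IsChain G.Adj) (hnd : l.Nodup) (hall : ∀ v, v ∈ l)
    (hlen : 3 ≤ l.length) (hne : l ≠ []) (hclose : G.Adj (l.getLast hne) (l.head hne)) :
    G.IsHamiltonian := by
  intro _
  have hs := Walk.support_ofSupport hne hl
  have hp : ((Walk.ofSupport l hne hl).IsPath) := by
    rw [Walk.isPath_def, hs]; exact hnd
  refine ⟨_, Walk.cons hclose (Walk.ofSupport l hne hl), ?_⟩
  rw [Walk.isHamiltonianCycle_iff_isCycle_and_support_count_tail_eq_one]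
  constructor
  · rw [Walk.isCycle_iff_isPath_tail_and_le_length]
    refine ⟨by simpa using hp, ?_⟩
    simp only [Walk.length_cons, Walk.length_ofSupport]
    omega
  · intro a
    simp only [Walk.support_cons, List.tail_cons, hs]
    exact List.count_eq_one_of_mem hnd (hall a)

theorem exists_alternating_list {V ι : Type*} [DecidableEq V] [DecidableEq ι]
    {G : SimpleGraph V} {A : Set V} (hAB : ∀ a ∈ A, ∀ b ∉ A, G.Adj a b) {u v : ι → V}
    (huv : Function.Injective (Sum.elim u v)) (Y : Finset V) :
    ∀ (I : Finset ι) (X : Finset V),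
    (∀ x ∈ X, x ∈ A) → (∀ y ∈ Y, y ∉ A) → (∀ i ∈ I, u i ∈ A ∧ v i ∈ A ∧ G.Adj (u i) (v i)) →
    (∀ i ∈ I, u i ∉ X ∧ v i ∉ X) →
    Y.card = X.card + I.card →
    ∃ l : List V, l.IsChain G.Adj ∧ l.Nodup ∧
      (∀ x, x ∈ l ↔ x ∈ X ∨ x ∈ Y ∨ ∃ i ∈ I, x = u i ∨ x = v i) ∧
      (∀ x ∈ l.head?, x ∈ A) ∧ (∀ x ∈ l.getLast?, x ∉ A) := by
  obtain ⟨hu, hv, huv⟩ := Sum.elim_injective.1 huv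
  induction Y using Finset.induction_on with
  | empty =>
    intro I X _ _ _ _ hc
    have hX : X = ∅ := by rw [← Finset.card_eq_zero]; simp at hc; omega
    have hI : I = ∅ := by rw [← Finset.card_eq_zero]; simp at hc; omega
    subst hX hI
    exact ⟨[], by simp⟩
  | insert y Y hy ih =>
    intro I X hX hY hI hIX hc
    rw [Finset.card_insert_of_notMem hy] at hc
    have hyA : y ∉ A := hY y (by simp)
    have hY' : ∀ z ∈ Y, z ∉ A := fun z hz => hY z (by simp [hz])
    rcases X.eq_empty_or_nonempty with rfl | ⟨x, hx⟩
    · obtain ⟨i, hi⟩ : I.Nonempty := by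
        rw [← Finset.card_pos]; simp at hc; omega
      have hsub : ∀ j ∈ I.erase i, j ∈ I := fun j hj => Finset.mem_of_mem_erase hj
      obtain ⟨l, h1, h2, h3, h4, h5⟩ := ih (I.erase i) ∅ (by simp) hY'
        (fun j hj => hI j (hsub j hj)) (by simp)
        (by rw [Finset.card_erase_of_mem hi]; simp at hc ⊢; have := Finset.card_pos.2 ⟨i, hi⟩; omega)
      obtain ⟨hui, hvi, hadj⟩ := hI i hi
      have hul : u i ∉ l := by
        rw [h3]; simp only [Finset.notMem_empty, false_or, not_or, not_exists, not_and]
        refine ⟨fun h => hY' _ h hui, fun j hj => ⟨fun h => ?_, fun h => huv i j h⟩⟩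
        exact (Finset.mem_erase.1 hj).1 (hu h.symm)
      have hvl : v i ∉ l := by
        rw [h3]; simp only [Finset.notMem_empty, false_or, not_or, not_exists, not_and]
        refine ⟨fun h => hY' _ h hvi, fun j hj => ⟨fun h => huv j i h.symm, fun h => ?_⟩⟩
        exact (Finset.mem_erase.1 hj).1 (hv h.symm)
      have hyl : y ∉ l := by
        rw [h3]; simp only [Finset.notMem_empty, false_or, not_or, not_exists, not_and]
        exact ⟨hy, fun j hj => ⟨fun h => hyA (h ▸ (hI j (hsub j hj)).1),
          fun h => hyA (h ▸ (hI j (hsub j hj)).2.1)⟩⟩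
      have hyu : u i ≠ y := fun h => hyA (h ▸ hui)
      have hyv : v i ≠ y := fun h => hyA (h ▸ hvi)
      refine ⟨u i :: v i :: y :: l, ?_, ?_, ?_, ?_, ?_⟩
      · refine .cons_cons hadj (.cons_cons (hAB _ hvi _ hyA) (List.isChain_cons.2 ⟨?_, h1⟩))
        exact fun z hz => (hAB _ (h4 z hz) _ hyA).symm
      · simp [h2, hul, hvl, hyl, hyu, hyv, huv i i]
      · intro x
        simp only [List.mem_cons, h3, Finset.mem_insert, Finset.mem_erase]
        constructor
        · rintro (h | h | h | h | h | ⟨j, hj, h⟩)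
          · exact .inr (.inr ⟨i, hi, .inl h⟩)
          · exact .inr (.inr ⟨i, hi, .inr h⟩)
          · tauto
          · tauto
          · tauto
          · exact .inr (.inr ⟨j, hj.2, h⟩)
        · rintro (h | h | ⟨j, hj, h⟩)
          · tauto
          · tauto
          · by_cases hji : j = i
            · subst hji; tauto
            · exact .inr (.inr (.inr (.inr (.inr ⟨j, ⟨hji, hj⟩, h⟩))))
      · simpa using hui
      · cases l with
        | nil => simpa using hyA
        | cons a l => simpa using h5
    · obtain ⟨l, h1, h2, h3, h4, h5⟩ := ih I (X.erase x) (fun z hz => hX z (Finset.mem_of_mem_erase hz))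
        hY' hI (fun i hi => ⟨fun h => (hIX i hi).1 (Finset.mem_of_mem_erase h),
          fun h => (hIX i hi).2 (Finset.mem_of_mem_erase h)⟩)
        (by rw [Finset.card_erase_of_mem hx]; have := Finset.card_pos.2 ⟨x, hx⟩; omega)
      have hxA := hX x hx
      have hxl : x ∉ l := by
        rw [h3]; simp only [Finset.mem_erase, not_or, not_exists, not_and]
        exact ⟨by simp, fun h => hY' _ h hxA, fun j hj => ⟨fun h => (hIX j hj).1 (h ▸ hx),
          fun h => (hIX j hj).2 (h ▸ hx)⟩⟩
      have hyl : y ∉ l := by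
        rw [h3]; simp only [Finset.mem_erase, not_or, not_exists, not_and]
        exact ⟨fun _ h => hyA (hX _ h), hy, fun j hj => ⟨fun h => hyA (h ▸ (hI j hj).1),
          fun h => hyA (h ▸ (hI j hj).2.1)⟩⟩
      have hxy : x ≠ y := fun h => hyA (h ▸ hxA)
      refine ⟨x :: y :: l, ?_, ?_, ?_, ?_, ?_⟩
      · refine .cons_cons (hAB _ hxA _ hyA) (List.isChain_cons.2 ⟨?_, h1⟩)
        exact fun z hz => (hAB _ (h4 z hz) _ hyA).symm
      · simp [h2, hxl, hyl, hxy]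
      · intro z
        simp only [List.mem_cons, h3, Finset.mem_insert, Finset.mem_erase]
        by_cases hz : z = x
        · subst hz; tauto
        · simp only [hz, ne_eq, not_false_eq_true, true_and, false_or, or_assoc, or_left_comm]
      · simpa using hxA
      · cases l with
        | nil => simpa using hyA
        | cons a l => simpa using h5

/-- Along a walk, each vertex of an independent set is preceded by a vertex outside it. -/
theorem Walk.countP_support_tail_le {V : Type*} {G : SimpleGraph V} {A : V → Prop} [DecidablePred A]
    (hB : ∀ x y, ¬ A x → ¬ A y → ¬ G.Adj x y) {a b : V} (p : G.Walk a b) :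
    p.support.tail.countP (fun x => ¬ A x) ≤ p.support.dropLast.countP (fun x => A x) := by
  induction p with
  | nil => simp
  | @cons x y z h p ih =>
    have h1 : p.support = y :: p.support.tail := (Walk.cons_tail_support p).symm
    have h2 : (Walk.cons h p).support.dropLast = x :: p.support.dropLast := by
      rw [Walk.support_cons, List.dropLast_cons_of_ne_nil p.support_ne_nil]
    rw [h2, Walk.support_cons, List.tail_cons, h1, List.countP_cons, List.countP_cons]
    have := hB x y
    have hxy : ¬ A y → A x := fun hy => by_contra fun hx => this hx hy h
    by_cases hx : A x <;> by_cases hy : A y <;> simp [hx, hy] <;> grind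

/-- In a graph with a Hamiltonian cycle, an independent set contains at most half the vertices. -/
theorem card_filter_not_le_of_isHamiltonian {V : Type*} [Fintype V] [DecidableEq V]
    {G : SimpleGraph V} {A : V → Prop} [DecidablePred A]
    (hB : ∀ x y, ¬ A x → ¬ A y → ¬ G.Adj x y) (hG : G.IsHamiltonian) (hc : Fintype.card V ≠ 1) :
    (Finset.univ.filter (fun x => ¬ A x)).card ≤ (Finset.univ.filter (fun x => A x)).card := by
  obtain ⟨a, p, hp⟩ := hG hc
  have h := p.countP_support_tail_le hB
  have hperm : List.Perm p.support.dropLast p.support.tail := by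
    have h1 : p.support = a :: p.support.tail := (Walk.cons_tail_support p).symm
    have h2 : p.support = p.support.dropLast ++ [a] := by
      conv_lhs => rw [← List.dropLast_append_getLast p.support_ne_nil]
      simp
    have h3 : List.Perm (a :: p.support.dropLast) (a :: p.support.tail) := by
      rw [← h1]; conv_rhs => rw [h2]
      exact (List.perm_append_singleton _ _).symm
    exact h3.cons_inv
  rw [hperm.countP_eq] at h
  rw [Walk.isHamiltonianCycle_iff_isCycle_and_support_count_tail_eq_one] at hp
  have key : ∀ (P : V → Prop) [DecidablePred P],
      p.support.tail.countP (fun x => P x) = (Finset.univ.filter P).card := by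
    intro P _
    rw [List.countP_eq_length_filter, ← List.toFinset_card_of_nodup
      ((List.nodup_iff_count_eq_one.2 fun x _ => hp.2 x).filter _)]
    congr 1
    ext x
    have : x ∈ p.support.tail := List.count_pos_iff.1 (by rw [hp.2 x]; simp)
    simp [this]
  rwa [key, key] at h
end SimpleGraph


/-- Quantitative Stirling estimate for the central binomial coefficient. -/
theorem abs_centralBinom_div_sub_le {n : ℕ} (hn : 0 < n) :
    |((2 * n).choose n : ℝ) / 4 ^ n - 1 / √(n * π)| ≤ 1 / (n * √(n * π)) := by
  set c : ℝ := ((2 * n).choose n : ℝ) / 4 ^ n with hc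
  have hn' : (0 : ℝ) < n := by exact_mod_cast hn
  have hc0 : 0 < c := by
    have : 0 < (2 * n).choose n := Nat.choose_pos (by omega)
    positivity
  have hW : Wallis.W n * (c ^ 2 * (2 * n + 1)) = 1 := by
    have hch : ((2 * n).choose n : ℝ) = (2 * n).factorial / ((n.factorial : ℝ) ^ 2) := by
      rw [Nat.cast_choose ℝ (by omega : n ≤ 2 * n), show 2 * n - n = n by omega, sq]
    have h2 : ((2 : ℝ) ^ (4 * n)) = (4 ^ n) ^ 2 := by
      rw [← pow_mul, mul_comm n 2, pow_mul, pow_mul]; norm_num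
    rw [Wallis.W_eq_factorial_ratio, hc, hch, h2]
    field_simp
  have hle := Wallis.W_le n
  have hge := Wallis.le_W n
  have hWp := Wallis.W_pos n
  have hs : 0 < √(n * π) := by positivity
  have hsq : √(n * π) ^ 2 = n * π := Real.sq_sqrt (by positivity)
  set y := c * √(n * π) with hy
  have hy0 : 0 < y := by positivity
  have hy2 : y ^ 2 = c ^ 2 * (n * π) := by rw [hy, mul_pow, hsq]
  have hpi := Real.pi_pos
  have hyW : y ^ 2 * (Wallis.W n * (2 * n + 1)) = n * π := by
    rw [hy2]; linear_combination (n * π) * hW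
  have hup : y ≤ 1 := by
    have h1 : n * π ≤ Wallis.W n * (2 * n + 1) := by
      have : n * π ≤ (2 * (n : ℝ) + 1) / (2 * n + 2) * (π / 2) * (2 * n + 1) := by
        rw [div_mul_eq_mul_div, div_mul_eq_mul_div, le_div_iff₀ (by positivity)]
        nlinarith
      nlinarith
    have h2 : y ^ 2 ≤ 1 := by
      by_contra! h
      nlinarith [mul_pos hWp (by positivity : (0 : ℝ) < 2 * n + 1)]
    nlinarith
  have hlo : 1 - 1 / n ≤ y := by
    have h1 : n * π ≤ y ^ 2 * (π / 2 * (2 * n + 1)) := by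
      rw [← hyW]; gcongr
    have h2 : 2 * n ≤ y ^ 2 * (2 * n + 1) := by
      by_contra! h
      nlinarith
    have h3 : y ^ 2 ≤ y := by nlinarith
    rw [sub_le_iff_le_add, ← sub_le_iff_le_add', le_div_iff₀ hn']
    nlinarith
  have hcy : c = y / √(n * π) := by rw [hy]; field_simp
  have hn0 : 0 ≤ 1 / (n : ℝ) := by positivity
  rw [hcy, ← sub_div, abs_div, abs_of_pos hs, ← div_div]
  gcongr
  rw [abs_le]
  constructor <;> linarith

theorem exists_forall_sq_mul_pow_le {r : ℝ} (h0 : 0 ≤ r) (h1 : r < 1) :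
    ∃ C : ℝ, 0 < C ∧ ∀ t : ℕ, ((t : ℝ) + 1) ^ 2 * r ^ t ≤ C := by
  have h := tendsto_pow_const_mul_const_pow_of_abs_lt_one 2 (r := r) (by rwa [abs_of_nonneg h0])
  obtain ⟨C, hC⟩ := h.bddAbove_range
  have h' := tendsto_pow_atTop_nhds_zero_of_lt_one h0 h1
  refine ⟨2 * |C| + 2, by positivity, fun t => ?_⟩
  have h2 : (t : ℝ) ^ 2 * r ^ t ≤ C := hC ⟨t, rfl⟩
  have h3 : r ^ t ≤ 1 := pow_le_one₀ h0 h1.le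
  have h4 : 0 ≤ r ^ t := by positivity
  have h5 := le_abs_self C
  nlinarith [sq_nonneg ((t : ℝ) - 1)]

theorem card_filter_le_card_eq {V : Type*} [Fintype V] [DecidableEq V] {n : ℕ}
    (hn : 0 < n) (hV : Fintype.card V = 2 * n) :
    2 * ((Finset.univ : Finset (Finset V)).filter (fun T => n - 1 ≤ T.card)).card
      = 4 ^ n + (2 * n).choose n + 2 * (2 * n).choose (n - 1) := by
  have hk (k : ℕ) : ((Finset.univ : Finset (Finset V)).filter (fun T => T.card = k)).card
      = (2 * n).choose k := by
    rw [Finset.univ_filter_card_eq, Finset.card_powersetCard, Finset.card_univ, hV]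
  have hsym : ((Finset.univ : Finset (Finset V)).filter (fun T => n < T.card)).card
      = ((Finset.univ : Finset (Finset V)).filter (fun T => T.card < n)).card := by
    refine Finset.card_bij' (fun T _ => Tᶜ) (fun T _ => Tᶜ) ?_ ?_ (by simp) (by simp) <;>
    · intro T hT
      have := T.card_le_univ
      simp only [Finset.mem_filter, Finset.mem_univ, true_and, Finset.card_compl, hV] at hT ⊢
      omega
  have htot : ((Finset.univ : Finset (Finset V)).filter (fun T => n < T.card)).card
      + ((Finset.univ : Finset (Finset V)).filter (fun T => T.card = n)).card
      + ((Finset.univ : Finset (Finset V)).filter (fun T => T.card < n)).card = 4 ^ n := by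
    rw [← Finset.card_union_of_disjoint, ← Finset.card_union_of_disjoint]
    · rw [show (4 : ℕ) ^ n = 2 ^ (2 * n) by rw [pow_mul]; norm_num, ← hV, ← Fintype.card_finset,
        ← Finset.card_univ]
      congr 1
      ext T; simp; omega
    · rw [Finset.disjoint_left]; intro T; simp; omega
    · rw [Finset.disjoint_left]; intro T; simp; omega
  have hdec : ((Finset.univ : Finset (Finset V)).filter (fun T => n - 1 ≤ T.card)).card
      = ((Finset.univ : Finset (Finset V)).filter (fun T => n < T.card)).card
      + ((Finset.univ : Finset (Finset V)).filter (fun T => T.card = n)).card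
      + ((Finset.univ : Finset (Finset V)).filter (fun T => T.card = n - 1)).card := by
    rw [← Finset.card_union_of_disjoint, ← Finset.card_union_of_disjoint]
    · congr 1
      ext T; simp; omega
    · rw [Finset.disjoint_left]; intro T; simp; omega
    · rw [Finset.disjoint_left]; intro T; simp; omega
  rw [hk] at htot hdec
  rw [hk] at hdec
  omega

/-- The main term, `P[B(2n, 1/2) ≥ n - 1]`. -/
theorem abs_card_filter_le_card_div_sub_le {V : Type*} [Fintype V] [DecidableEq V] {n : ℕ}
    (hn : 0 < n) (hV : Fintype.card V = 2 * n) :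
    |(((Finset.univ : Finset (Finset V)).filter (fun T => n - 1 ≤ T.card)).card : ℝ) / 4 ^ n
      - (1 / 2 + (3 / 2) / √(n * π))| ≤ 4 / (n * √(n * π)) := by
  have hn' : (0 : ℝ) < n := by exact_mod_cast hn
  have hs : 0 < √(n * π) := by positivity
  have hcount := card_filter_le_card_eq (V := V) hn hV
  set N := ((Finset.univ : Finset (Finset V)).filter (fun T => n - 1 ≤ T.card)).card
  have hch : ((2 * n).choose (n - 1) : ℝ) * (n + 1) = (2 * n).choose n * n := by
    have := Nat.choose_succ_right_eq (2 * n) (n - 1)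
    rw [show n - 1 + 1 = n by omega, show 2 * n - (n - 1) = n + 1 by omega] at this
    exact_mod_cast this.symm
  have hcount' : 2 * (N : ℝ) = 4 ^ n + (2 * n).choose n + 2 * (2 * n).choose (n - 1) := by
    exact_mod_cast hcount
  have hst := abs_centralBinom_div_sub_le hn
  set c : ℝ := ((2 * n).choose n : ℝ) / 4 ^ n with hc
  have hc0 : 0 ≤ c := by positivity
  have hN : (N : ℝ) / 4 ^ n - (1 / 2 + (3 / 2) / √(n * π))
      = 3 / 2 * (c - 1 / √(n * π)) - c / (n + 1) := by
    have h1 : ((2 * n).choose (n - 1) : ℝ) = (2 * n).choose n * n / (n + 1) := by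
      rw [eq_div_iff (by positivity), hch]
    have h2 : (N : ℝ) = (4 ^ n + (2 * n).choose n + 2 * ((2 * n).choose n * n / (n + 1))) / 2 := by
      rw [← h1]; linarith
    rw [h2, hc]; field_simp; ring
  have hcle : c / (n + 1) ≤ 2 / (n * √(n * π)) := by
    have h1 : 1 / (n * √(n * π)) ≤ 1 / √(n * π) := by
      apply one_div_le_one_div_of_le hs
      have : (1 : ℝ) ≤ n := by exact_mod_cast hn
      nlinarith
    have h2 : c ≤ 2 / √(n * π) := by
      have := (abs_le.1 hst).2
      have h3 : 2 / √(n * π) = 1 / √(n * π) + 1 / √(n * π) := by ring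
      linarith
    calc c / (n + 1) ≤ c / n := by gcongr; linarith
      _ ≤ (2 / √(n * π)) / n := by gcongr
      _ = _ := by field_simp
  have h0 : 0 ≤ c / (n + 1) := by positivity
  have e1 : 4 / (n * √(n * π)) = 4 * (1 / (n * √(n * π))) := by ring
  have e2 : 2 / (n * √(n * π)) = 2 * (1 / (n * √(n * π))) := by ring
  rw [e2] at hcle
  obtain ⟨hl, hr⟩ := abs_le.1 hst
  have hpos : 0 ≤ 1 / (n * √(n * π)) := by positivity
  rw [hN, e1, abs_le]
  constructor <;> linarith

theorem sum_powerset_pow_card_filter {V ι : Type*} [DecidableEq V] [DecidableEq ι] {u v : ι → V}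
    (huv : Function.Injective (Sum.elim u v)) (I : Finset ι) :
    ∀ W : Finset V, (∀ i ∈ I, u i ∈ W ∧ v i ∈ W) →
    ∑ S ∈ W.powerset, ((1 : ℝ) / 2) ^ (I.filter fun i => u i ∈ S ∧ v i ∈ S).card
      = 2 ^ W.card * (7 / 8) ^ I.card := by
  obtain ⟨hu, hv, huv⟩ := Sum.elim_injective.1 huv
  induction I using Finset.induction_on with
  | empty => intro W _; simp
  | insert i I hi ih =>
    intro W hW
    obtain ⟨hui, hvi⟩ := hW i (by simp)
    have hvu : v i ∈ W.erase (u i) := by simp [hvi, (huv i i).symm]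
    set W' := (W.erase (u i)).erase (v i) with hW'
    have hvW' : v i ∉ W' := by simp [hW']
    have huW' : u i ∉ insert (v i) W' := by simp [hW', huv i i]
    have hWi : W = insert (u i) (insert (v i) W') := by
      rw [hW', Finset.insert_erase hvu, Finset.insert_erase hui]
    have hne : ∀ j ∈ I, j ≠ i := fun j hj h => hi (h ▸ hj)
    have hIH := ih W' (fun j hj => by
      have := hW j (by simp [hj])
      simp [hW', this, hu.eq_iff, hv.eq_iff, hne j hj, huv j i, (huv i j).symm])
    rw [hWi, Finset.sum_powerset_insert huW', Finset.sum_powerset_insert hvW',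
      Finset.sum_powerset_insert hvW', Finset.card_insert_of_notMem huW',
      Finset.card_insert_of_notMem hvW', Finset.card_insert_of_notMem hi,
      ← Finset.sum_add_distrib, ← Finset.sum_add_distrib, ← Finset.sum_add_distrib]
    have hterm : ∀ S ∈ W'.powerset,
        ((1 : ℝ) / 2) ^ ((insert i I).filter fun j => u j ∈ S ∧ v j ∈ S).card
        + (1 / 2) ^ ((insert i I).filter fun j => u j ∈ insert (v i) S ∧ v j ∈ insert (v i) S).card
        + ((1 / 2) ^ ((insert i I).filter fun j => u j ∈ insert (u i) S ∧ v j ∈ insert (u i) S).card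
        + (1 / 2) ^ ((insert i I).filter fun j => u j ∈ insert (u i) (insert (v i) S) ∧
            v j ∈ insert (u i) (insert (v i) S)).card)
        = (7 / 2) * (1 / 2) ^ (I.filter fun j => u j ∈ S ∧ v j ∈ S).card := by
      intro S hS
      have hS := Finset.mem_powerset.1 hS
      have huS : u i ∉ S := fun h => huW' (by simp [hS h])
      have hvS : v i ∉ S := fun h => hvW' (hS h)
      have hmem : ∀ j ∈ I, u j ≠ u i ∧ v j ≠ v i := fun j hj =>
        ⟨hu.ne (hne j hj), hv.ne (hne j hj)⟩
      have h1 : (insert i I).filter (fun j => u j ∈ S ∧ v j ∈ S)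
          = I.filter fun j => u j ∈ S ∧ v j ∈ S := by
        rw [Finset.filter_insert, if_neg (by simp [huS])]
      have h2 : (insert i I).filter (fun j => u j ∈ insert (v i) S ∧ v j ∈ insert (v i) S)
          = I.filter fun j => u j ∈ S ∧ v j ∈ S := by
        rw [Finset.filter_insert, if_neg (by simp [huS, huv i i])]
        exact Finset.filter_congr fun j hj => by simp [hmem j hj, huv j i]
      have h3 : (insert i I).filter (fun j => u j ∈ insert (u i) S ∧ v j ∈ insert (u i) S)
          = I.filter fun j => u j ∈ S ∧ v j ∈ S := by
        rw [Finset.filter_insert, if_neg (by simp [hvS, (huv i i).symm])]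
        exact Finset.filter_congr fun j hj => by simp [hmem j hj, (huv i j).symm]
      have h4 : (insert i I).filter (fun j => u j ∈ insert (u i) (insert (v i) S) ∧
            v j ∈ insert (u i) (insert (v i) S))
          = insert i (I.filter fun j => u j ∈ S ∧ v j ∈ S) := by
        rw [Finset.filter_insert, if_pos (by simp)]
        congr 1
        exact Finset.filter_congr fun j hj => by simp [hmem j hj, (huv i j).symm, huv j i]
      rw [h1, h2, h3, h4, Finset.card_insert_of_notMem (by simp [hi]), pow_succ]
      ring
    rw [Finset.sum_congr rfl hterm, ← Finset.mul_sum, hIH]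
    ring

theorem card_filter_le_sum {α : Type*} [Fintype α] (p : α → Prop) [DecidablePred p] (f : α → ℝ)
    (h0 : ∀ a, 0 ≤ f a) (h1 : ∀ a, p a → 1 ≤ f a) :
    ((Finset.univ.filter p).card : ℝ) ≤ ∑ a, f a := by
  rw [Finset.card_filter, Nat.cast_sum]
  refine Finset.sum_le_sum fun a _ => ?_
  split_ifs with h
  · simpa using h1 a h
  · simpa using h0 a

theorem card_filter_matching_lt_le {V ι : Type*} [Fintype V] [DecidableEq V] [Fintype ι]
    [DecidableEq ι] {u v : ι → V} (huv : Function.Injective (Sum.elim u v)) {t : ℕ}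
    (ht : 6 * t ≤ Fintype.card ι) :
    ((Finset.univ.filter fun S : Finset V =>
      (Finset.univ.filter fun i => u i ∈ S ∧ v i ∈ S).card < t).card : ℝ)
      ≤ 2 ^ Fintype.card V * (97 / 100) ^ t := by
  have h := sum_powerset_pow_card_filter huv Finset.univ Finset.univ (by simp)
  rw [Finset.powerset_univ, Finset.card_univ, Finset.card_univ] at h
  calc _ ≤ ∑ S : Finset V, (2 : ℝ) ^ t * (1 / 2) ^
        (Finset.univ.filter fun i => u i ∈ S ∧ v i ∈ S).card := by
        refine card_filter_le_sum _ _ (fun _ => by positivity) fun S hS => ?_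
        obtain ⟨k, hk⟩ := Nat.exists_eq_add_of_le hS.le
        rw [hk, pow_add, mul_right_comm, ← mul_pow]
        norm_num
        exact one_le_pow₀ (by norm_num)
    _ = 2 ^ Fintype.card V * (2 ^ t * (7 / 8) ^ Fintype.card ι) := by
        rw [← Finset.mul_sum, h]; ring
    _ ≤ 2 ^ Fintype.card V * (2 ^ t * (7 / 8) ^ (6 * t)) := by
        gcongr 2 ^ Fintype.card V * (2 ^ t * ?_)
        exact pow_le_pow_of_le_one (by norm_num) (by norm_num) ht
    _ ≤ _ := by
        rw [pow_mul, ← mul_pow]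
        gcongr
        norm_num

theorem card_filter_card_ge_le {V : Type*} [Fintype V] [DecidableEq V] {n t : ℕ}
    (hn : 0 < n) (hV : Fintype.card V = 2 * n) (ht : n ≤ 25 * t + 24) :
    ((Finset.univ.filter fun T : Finset V => n - 1 + t ≤ T.card).card : ℝ)
      ≤ 2 * (4 ^ n * (97 / 100) ^ t) := by
  have h := Fintype.sum_pow_mul_eq_add_pow V (11 / 10 : ℝ) 1
  rw [hV] at h
  calc _ ≤ ∑ T : Finset V, (10 / 11 : ℝ) ^ (n - 1 + t) *
        ((11 / 10) ^ T.card * 1 ^ (2 * n - T.card)) := by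
        refine card_filter_le_sum _ _ (fun _ => by positivity) fun T hT => ?_
        obtain ⟨k, hk⟩ := Nat.exists_eq_add_of_le hT
        rw [hk, pow_add (11 / 10 : ℝ), one_pow, mul_one, ← mul_assoc, ← mul_pow]
        norm_num
        exact one_le_pow₀ (by norm_num)
    _ = 4 ^ n * ((11 / 10) * ((441 / 440) ^ n * (10 / 11) ^ t)) := by
        rw [← Finset.mul_sum, h]
        obtain ⟨m, rfl⟩ : ∃ m, n = m + 1 := ⟨n - 1, by omega⟩
        have e : (4 : ℝ) ^ (m + 1) * (441 / 440) ^ (m + 1)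
            = ((11 / 10 + 1) ^ 2) ^ (m + 1) * (10 / 11) ^ (m + 1) := by
          rw [← mul_pow, ← mul_pow]; norm_num
        rw [Nat.add_sub_cancel, pow_mul, pow_add (10 / 11 : ℝ) m t]
        rw [pow_succ (10 / 11 : ℝ) m] at e
        linear_combination (-(11 / 10) * (10 / 11) ^ t) * e
    _ ≤ 4 ^ n * ((11 / 10) * ((441 / 440) ^ (25 * t + 24) * (10 / 11) ^ t)) := by
        gcongr
        norm_num
    _ = 4 ^ n * ((11 / 10) * (441 / 440) ^ 24 * ((441 / 440) ^ 25 * (10 / 11)) ^ t) := by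
        rw [pow_add, pow_mul, mul_pow]; ring
    _ ≤ 4 ^ n * (2 * (97 / 100) ^ t) := by
        gcongr <;> norm_num
    _ = _ := by ring

theorem SimpleGraph.exists_matching_of_two_regular {V : Type*} [Fintype V] [DecidableEq V]
    {G : SimpleGraph V}
    {A : Finset V} (hA : ∀ a ∈ A, {b | b ∈ A ∧ G.Adj a b}.ncard = 2) (k : ℕ)
    (hk : 4 * k < A.card + 4) :
    ∃ u v : Fin k → V, Function.Injective (Sum.elim u v) ∧
      ∀ i, u i ∈ A ∧ v i ∈ A ∧ G.Adj (u i) (v i) := by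
  classical
  induction k with
  | zero => exact ⟨Fin.elim0, Fin.elim0, Function.injective_of_subsingleton _, fun i => i.elim0⟩
  | succ k ih =>
    obtain ⟨u, v, huv, h⟩ := ih (by omega)
    let N : V → Finset V := fun a => A.filter fun b => G.Adj a b
    have hN : ∀ a ∈ A, (N a).card = 2 := fun a ha => by
      rw [← hA a ha, ← Set.ncard_coe_finset]; congr 1; ext b; simp [N]
    obtain ⟨x, hx, hxU⟩ : ∃ x ∈ A, x ∉ Finset.univ.biUnion fun i => N (u i) ∪ N (v i) := by
      apply Finset.exists_mem_notMem_of_card_lt_card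
      calc _ ≤ ∑ i : Fin k, (N (u i) ∪ N (v i)).card := Finset.card_biUnion_le
        _ ≤ ∑ i : Fin k, 4 := Finset.sum_le_sum fun i _ => by
            have := Finset.card_union_le (N (u i)) (N (v i))
            rw [hN _ (h i).1, hN _ (h i).2.1] at this
            exact this
        _ < A.card := by simp; omega
    obtain ⟨y, hy⟩ : (N x).Nonempty := by rw [← Finset.card_pos, hN x hx]; norm_num
    simp only [Finset.mem_biUnion, Finset.mem_univ, true_and, Finset.mem_union, not_exists, not_or,
      N, Finset.mem_filter] at hxU hy
    obtain ⟨hu, hv, huv⟩ := Sum.elim_injective.1 huv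
    have hxu : ∀ i, x ≠ u i := fun i e => (hxU i).2 ⟨hx, e ▸ (h i).2.2.symm⟩
    have hxv : ∀ i, x ≠ v i := fun i e => (hxU i).1 ⟨hx, e ▸ (h i).2.2⟩
    have hyu : ∀ i, y ≠ u i := fun i e => (hxU i).1 ⟨hx, e ▸ hy.2.symm⟩
    have hyv : ∀ i, y ≠ v i := fun i e => (hxU i).2 ⟨hx, e ▸ hy.2.symm⟩
    refine ⟨Fin.cons x u, Fin.cons y v, Sum.elim_injective.2 ⟨?_, ?_, ?_⟩, ?_⟩
    · rw [Fin.cons_injective_iff]; exact ⟨by simpa using fun i => (hxu i).symm, hu⟩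
    · rw [Fin.cons_injective_iff]; exact ⟨by simpa using fun i => (hyv i).symm, hv⟩
    · intro i j
      induction i using Fin.cases <;> induction j using Fin.cases <;>
        simp [hxv, huv, hy.2.ne, fun i => (hyu i).symm]
    · intro i
      induction i using Fin.cases
      · exact ⟨hx, hy⟩
      · simpa using h _

theorem exists_inExtremalFamily {n : ℕ} (hn : 2 ≤ n) :
    ∃ G : SimpleGraph (Fin (2 * n)), InExtremalFamily n G := by
  let G : SimpleGraph (Fin (2 * n)) :=
    { Adj := fun x y => (x.val ≤ n ∧ n < y.val) ∨ (n < x.val ∧ y.val ≤ n) ∨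
        (x.val ≤ n ∧ y.val ≤ n ∧ (x.val + 1 = y.val ∨ y.val + 1 = x.val ∨
          (x.val = 0 ∧ y.val = n) ∨ (x.val = n ∧ y.val = 0)))
      symm := ⟨fun x y => by omega⟩
      loopless := ⟨fun x => by omega⟩ }
  refine ⟨G, Finset.univ.filter (fun x => x.val ≤ n), ?_, ?_, ?_, ?_⟩
  · have : Finset.univ.filter (fun x : Fin (2 * n) => x.val ≤ n)
        = Finset.Iic (⟨n, by omega⟩ : Fin (2 * n)) := by
      ext x; simp [Fin.le_def]
    rw [this, Fin.card_Iic]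
  · intro a ha b hb
    simp only [Finset.mem_filter, Finset.mem_univ, true_and, Finset.mem_compl] at ha hb
    exact .inl ⟨ha, by omega⟩
  · intro a ha b hb
    simp only [Finset.mem_filter, Finset.mem_univ, true_and, Finset.mem_compl] at ha hb
    simp only [G]; omega
  · intro a ha
    simp only [Finset.mem_filter, Finset.mem_univ, true_and] at ha
    let s : Fin (2 * n) := ⟨if a.val = n then 0 else a.val + 1, by split_ifs <;> omega⟩
    let p : Fin (2 * n) := ⟨if a.val = 0 then n else a.val - 1, by split_ifs <;> omega⟩
    have hsp : s ≠ p := by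
      intro h
      have := congrArg Fin.val h
      simp only [s, p] at this
      split_ifs at this <;> omega
    refine Eq.trans (congrArg Set.ncard ?_) (Set.ncard_pair hsp)
    ext b
    simp only [Set.mem_ofPred_eq, Finset.mem_filter, Finset.mem_univ, true_and, G,
      Set.mem_insert_iff, Set.mem_singleton_iff, Fin.ext_iff, s, p]
    split_ifs <;> omega

theorem SimpleGraph.isHamiltonian_induce_of_matching {V ι : Type*} [Fintype V] [DecidableEq V]
    [Fintype ι] [DecidableEq ι] {G : SimpleGraph V} {A : Finset V}
    (hAB : ∀ a ∈ A, ∀ b ∈ Aᶜ, G.Adj a b) {u v : ι → V}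
    (huv : Function.Injective (Sum.elim u v)) (hA : ∀ i, u i ∈ A ∧ v i ∈ A ∧ G.Adj (u i) (v i))
    (S : Finset V) (h1 : (S \ A).card ≤ (S ∩ A).card)
    (h2 : (S ∩ A).card ≤ (S \ A).card + (Finset.univ.filter fun i => u i ∈ S ∧ v i ∈ S).card)
    (h3 : 2 ≤ (S \ A).card) [Fintype (S : Set V)] [DecidableEq (S : Set V)] :
    (G.induce (S : Set V)).IsHamiltonian := by
  obtain ⟨I, hI, hIc⟩ := Finset.exists_subset_card_eq
    (show (S ∩ A).card - (S \ A).card ≤ (Finset.univ.filter fun i => u i ∈ S ∧ v i ∈ S).card by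
      omega)
  have hIS : ∀ i ∈ I, u i ∈ S ∧ v i ∈ S := fun i hi => by simpa using hI hi
  obtain ⟨hu, hv, huv'⟩ := Sum.elim_injective.1 huv
  have hPsub : I.image u ∪ I.image v ⊆ S ∩ A := by
    intro x hx
    simp only [Finset.mem_union, Finset.mem_image] at hx
    rcases hx with ⟨i, hi, rfl⟩ | ⟨i, hi, rfl⟩
    · exact Finset.mem_inter.2 ⟨(hIS i hi).1, (hA i).1⟩
    · exact Finset.mem_inter.2 ⟨(hIS i hi).2, (hA i).2.1⟩
  have hPc : (I.image u ∪ I.image v).card = I.card + I.card := by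
    rw [Finset.card_union_of_disjoint, Finset.card_image_of_injective _ hu,
      Finset.card_image_of_injective _ hv]
    rw [Finset.disjoint_left]
    intro x hx hy
    obtain ⟨i, _, rfl⟩ := Finset.mem_image.1 hx
    obtain ⟨j, _, hj⟩ := Finset.mem_image.1 hy
    exact huv' i j hj.symm
  have hPle := Finset.card_le_card hPsub
  obtain ⟨l, hl, hnd, hmem, hhead, hlast⟩ := SimpleGraph.exists_alternating_list (G := G)
    (A := (A : Set V)) (fun a ha b hb => hAB a ha b (by simpa using hb)) huv (S \ A) I
    ((S ∩ A) \ (I.image u ∪ I.image v)) (fun x hx => by simp at hx; simpa using hx.1.2)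
    (fun y hy => by simp at hy; simpa using hy.2) (fun i _ => by simpa using hA i)
    (fun i hi => by
      constructor <;> simp only [Finset.mem_sdiff, Finset.mem_union, not_and, not_not]
      · exact fun _ => .inl (Finset.mem_image_of_mem _ hi)
      · exact fun _ => .inr (Finset.mem_image_of_mem _ hi))
    (by rw [Finset.card_sdiff_of_subset hPsub]; omega)
  have hmemS : ∀ x, x ∈ l ↔ x ∈ S := by
    intro x
    rw [hmem]
    constructor
    · rintro (h | h | ⟨i, hi, rfl | rfl⟩)
      · simp at h; exact h.1.1
      · simp at h; exact h.1
      · exact (hIS i hi).1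
      · exact (hIS i hi).2
    · intro hx
      by_cases hxA : x ∈ A
      · by_cases hxP : x ∈ I.image u ∪ I.image v
        · simp only [Finset.mem_union, Finset.mem_image] at hxP
          rcases hxP with ⟨i, hi, rfl⟩ | ⟨i, hi, rfl⟩
          · exact .inr (.inr ⟨i, hi, .inl rfl⟩)
          · exact .inr (.inr ⟨i, hi, .inr rfl⟩)
        · exact .inl (Finset.mem_sdiff.2 ⟨Finset.mem_inter.2 ⟨hx, hxA⟩, hxP⟩)
      · exact .inr (.inl (Finset.mem_sdiff.2 ⟨hx, hxA⟩))
  have hlen : l.length = S.card := by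
    rw [← List.toFinset_card_of_nodup hnd]
    congr 1
    ext x; simp [hmemS]
  have hcard := Finset.card_inter_add_card_sdiff S A
  have hlen3 : 3 ≤ l.length := by omega
  clear hmem hlen
  lift l to List (S : Set V) using fun x hx => by simpa using (hmemS x).1 hx
  rw [List.isChain_map] at hl
  rw [List.length_map] at hlen3
  have hne : l ≠ [] := by rintro rfl; simp at hlen3
  refine SimpleGraph.isHamiltonian_of_list l hl (List.Nodup.of_map _ hnd) ?_ hlen3 hne ?_
  · intro x
    have := (hmemS x).2 (by simp)
    simpa using this
  · have ha := hhead (l.head hne : V) (by rw [List.head?_map, List.head?_eq_some_head hne]; rfl)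
    have hb := hlast (l.getLast hne : V) (by rw [List.getLast?_map, List.getLast?_eq_some_getLast hne]; rfl)
    exact (hAB _ (by simpa using ha) _ (by simpa using hb)).symm

theorem SimpleGraph.card_sdiff_le_of_isHamiltonian_induce {V : Type*} [DecidableEq V]
    {G : SimpleGraph V} {A S : Finset V} (hB : ∀ x ∉ A, ∀ y ∉ A, ¬ G.Adj x y)
    [Fintype (S : Set V)] [DecidableEq (S : Set V)]
    (hG : (G.induce (S : Set V)).IsHamiltonian) (hS : S.card ≠ 1) :
    (S \ A).card ≤ (S ∩ A).card := by
  have h := SimpleGraph.card_filter_not_le_of_isHamiltonian (A := fun x : (S : Set V) => (x : V) ∈ A)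
    (fun x y hx hy => hB x hx y hy) hG
    (by rwa [← Nat.card_eq_fintype_card, Nat.card_coe_set_eq, Set.ncard_coe_finset])
  have h1 : (S \ A).card = (Finset.univ.filter fun x : (S : Set V) => (x : V) ∉ A).card := by
    rw [← Finset.card_map (Function.Embedding.subtype _)]
    congr 1; ext x; simp [and_comm]
  have h2 : (S ∩ A).card = (Finset.univ.filter fun x : (S : Set V) => (x : V) ∈ A).card := by
    rw [← Finset.card_map (Function.Embedding.subtype _)]
    congr 1; ext x; simp [and_comm]
  rwa [h1, h2]

/-- Flipping membership outside `A` turns the difference of `#(S ∩ A)` and `#(S \ A)` into a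
shifted cardinality. -/
theorem card_filter_symmDiff_compl {V : Type*} [Fintype V] [DecidableEq V] {A : Finset V} {m : ℕ}
    (hA : Aᶜ.card = m) (t : ℕ) :
    (Finset.univ.filter fun S : Finset V => (S \ A).card + t ≤ (S ∩ A).card).card
      = (Finset.univ.filter fun T : Finset V => m + t ≤ T.card).card := by
  have hcard (S : Finset V) : (symmDiff S Aᶜ).card + (S \ A).card = (S ∩ A).card + m := by
    have h1 : symmDiff S Aᶜ = (S ∩ A) ∪ (Aᶜ \ (S \ A)) := by
      ext x; simp [Finset.mem_symmDiff]; tauto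
    have h2 : S \ A ⊆ Aᶜ := fun x hx => by simp at hx; simpa using hx.2
    have h3 := Finset.card_le_card h2
    rw [h1, Finset.card_union_of_disjoint, Finset.card_sdiff_of_subset h2]
    · omega
    · rw [Finset.disjoint_left]; intro x; simp; tauto
  refine Finset.card_bij' (fun S _ => symmDiff S Aᶜ) (fun T _ => symmDiff T Aᶜ) ?_ ?_ (by simp)
    (by simp)
  · intro S hS
    have := hcard S
    simp only [Finset.mem_filter, Finset.mem_univ, true_and] at hS ⊢
    omega
  · intro T hT
    have := hcard (symmDiff T Aᶜ)
    simp only [symmDiff_symmDiff_cancel_right] at this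
    simp only [Finset.mem_filter, Finset.mem_univ, true_and] at hT ⊢
    omega

theorem abs_hamProb_sub_le {n : ℕ} (hn : 50 ≤ n) {G : SimpleGraph (Fin (2 * n))}
    (hG : InExtremalFamily n G) :
    |hamProb n G - (1 / 2 + (3 / 2) / √(n * π))|
      ≤ 4 / (n * √(n * π)) + 3 * (97 / 100) ^ (n / 25) := by
  classical
  obtain ⟨A, hAc, hAB, hB, hreg⟩ := hG
  obtain ⟨u, v, huv, hM⟩ := SimpleGraph.exists_matching_of_two_regular hreg ((n + 4) / 4)
    (by omega)
  set t := n / 25 with ht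
  have hBc : Aᶜ.card = n - 1 := by rw [Finset.card_compl, hAc, Fintype.card_fin]; omega
  let ham := Finset.univ.filter fun S : Finset (Fin (2 * n)) =>
    (G.induce (↑S : Set (Fin (2 * n)))).IsHamiltonian
  let good := Finset.univ.filter fun S : Finset (Fin (2 * n)) => (S \ A).card ≤ (S ∩ A).card
  let few := Finset.univ.filter fun S : Finset (Fin (2 * n)) =>
      (Finset.univ.filter fun i => u i ∈ S ∧ v i ∈ S).card < t
  let far := Finset.univ.filter fun S : Finset (Fin (2 * n)) => (S \ A).card + t ≤ (S ∩ A).card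
  have hham : hamProb n G = (ham.card : ℝ) / 4 ^ n := by
    rw [hamProb, pow_mul, Nat.card_eq_fintype_card, Fintype.card_subtype]
    norm_num
    congr!
  have hupper : ham.card ≤ good.card + 2 * n := by
    have hsub : ham ⊆ good ∪ Finset.univ.powersetCard 1 := by
      intro S hS
      simp only [ham, good, Finset.mem_union, Finset.mem_filter, Finset.mem_univ, true_and,
        Finset.mem_powersetCard, Finset.subset_univ] at hS ⊢
      by_cases h : S.card = 1
      · exact .inr h
      · exact .inl (SimpleGraph.card_sdiff_le_of_isHamiltonian_induce
          (fun x hx y hy => hB x (by simpa using hx) y (by simpa using hy)) hS h)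
    refine (Finset.card_le_card hsub).trans ((Finset.card_union_le _ _).trans ?_)
    simp
  have hlower : good.card ≤ ham.card + few.card + far.card := by
    have hsub : good ⊆ (ham ∪ few) ∪ far := by
      intro S hS
      simp only [ham, few, far, good, Finset.mem_union, Finset.mem_filter, Finset.mem_univ,
        true_and] at hS ⊢
      by_contra! hcon
      obtain ⟨⟨hnh, hfew⟩, hfar⟩ := hcon
      set J := Finset.univ.filter fun i => u i ∈ S ∧ v i ∈ S with hJ
      have h2J : J.card + J.card ≤ (S ∩ A).card := by
        have := Finset.card_le_card_of_injOn (s := J.disjSum J) (t := S ∩ A) (Sum.elim u v) (by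
          rintro (i | i) hi <;> simp [hJ] at hi ⊢
          · exact ⟨hi.1, (hM i).1⟩
          · exact ⟨hi.2, (hM i).2.1⟩) huv.injOn
        rwa [Finset.card_disjSum] at this
      have hle : (S ∩ A).card ≤ (S \ A).card + J.card := by omega
      exact hnh (SimpleGraph.isHamiltonian_induce_of_matching hAB huv hM S hS (by convert hle)
        (by omega))
    refine (Finset.card_le_card hsub).trans ((Finset.card_union_le _ _).trans ?_)
    gcongr
    exact Finset.card_union_le _ _
  have hgood : good.card
      = (Finset.univ.filter fun T : Finset (Fin (2 * n)) => n - 1 ≤ T.card).card :=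
    card_filter_symmDiff_compl hBc 0
  have hmain := abs_card_filter_le_card_div_sub_le (n := n) (by omega) (Fintype.card_fin _)
  rw [← hgood] at hmain
  have h4 : (2 : ℝ) ^ (2 * n) = 4 ^ n := by rw [pow_mul]; norm_num
  have hfew : (few.card : ℝ) ≤ 4 ^ n * (97 / 100) ^ t := by
    have := card_filter_matching_lt_le huv (t := t) (by rw [Fintype.card_fin]; omega)
    rwa [Fintype.card_fin, h4] at this
  have hfar : (far.card : ℝ) ≤ 2 * (4 ^ n * (97 / 100) ^ t) := by
    have := card_filter_card_ge_le (n := n) (t := t) (by omega) (Fintype.card_fin _) (by omega)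
    rwa [← card_filter_symmDiff_compl hBc t] at this
  have hone : (2 * n : ℝ) ≤ 3 * (4 ^ n * (97 / 100) ^ t) := by
    have h1 : (n : ℝ) ≤ 2 ^ n := by exact_mod_cast Nat.lt_two_pow_self.le
    have h2 : (1 / 2 : ℝ) ^ n ≤ (97 / 100) ^ t :=
      (pow_le_pow_left₀ (by norm_num) (by norm_num) n).trans
        (pow_le_pow_of_le_one (by norm_num) (by norm_num) (Nat.div_le_self n 25))
    have h3 : (2 : ℝ) ^ n = 4 ^ n * (1 / 2) ^ n := by rw [← mul_pow]; norm_num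
    have h5 : (2 : ℝ) ^ n ≤ 4 ^ n * (97 / 100) ^ t := by rw [h3]; gcongr
    nlinarith
  have hdiff : |(ham.card : ℝ) / 4 ^ n - good.card / 4 ^ n| ≤ 3 * (97 / 100) ^ t := by
    have hu : (ham.card : ℝ) ≤ good.card + 2 * n := by exact_mod_cast hupper
    have hl : (good.card : ℝ) ≤ ham.card + few.card + far.card := by exact_mod_cast hlower
    rw [← sub_div, abs_div, abs_of_pos (by positivity : (0 : ℝ) < 4 ^ n),
      div_le_iff₀ (by positivity), abs_le]
    constructor <;> linarith
  rw [hham]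
  calc _ = |((good.card : ℝ) / 4 ^ n - (1 / 2 + (3 / 2) / √(n * π)))
        + ((ham.card : ℝ) / 4 ^ n - good.card / 4 ^ n)| := by congr 1; ring
    _ ≤ _ := (abs_add_le _ _).trans (add_le_add hmain hdiff)

theorem abs_csInf_sub_le {s : Set ℝ} (hs : s.Nonempty) {c ε : ℝ} (h : ∀ x ∈ s, |x - c| ≤ ε) :
    |sInf s - c| ≤ ε := by
  obtain ⟨x, hx⟩ := hs
  have hlb : c - ε ∈ lowerBounds s := fun y hy => by linarith [(abs_le.1 (h y hy)).1]
  rw [abs_le]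
  constructor
  · linarith [le_csInf ⟨x, hx⟩ hlb]
  · linarith [csInf_le ⟨_, hlb⟩ hx, (abs_le.1 (h x hx)).2]

/-- **Second-order estimate for the extremal probability:**
`pₙ = min_{G ∈ 𝒢ₙ} P[G[1/2] Hamiltonian] = 1/2 + (3/2)/√(nπ) + O(n^{-3/2})`. -/
theorem extremal_family_prob_estimate :
    ∃ C : ℝ, 0 < C ∧ ∃ n₀ : ℕ, ∀ n : ℕ, n₀ ≤ n →
      |sInf {x : ℝ | ∃ G : SimpleGraph (Fin (2 * n)), InExtremalFamily n G ∧ x = hamProb n G}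
          - (1 / 2 + (3 / 2) / Real.sqrt (n * Real.pi))|
        ≤ C / (n : ℝ) ^ ((3 : ℝ) / 2) := by
  obtain ⟨C, hC0, hC⟩ := exists_forall_sq_mul_pow_le (r := 97 / 100) (by norm_num) (by norm_num)
  refine ⟨4 + 3 * (625 * C), by positivity, 50, fun n hn => ?_⟩
  have hne : {x : ℝ | ∃ G : SimpleGraph (Fin (2 * n)),
      InExtremalFamily n G ∧ x = hamProb n G}.Nonempty := by
    obtain ⟨G, hG⟩ := exists_inExtremalFamily (n := n) (by omega)
    exact ⟨_, G, hG, rfl⟩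
  refine abs_csInf_sub_le hne ?_
  rintro x ⟨G, hG, rfl⟩
  refine (abs_hamProb_sub_le hn hG).trans ?_
  have hn1 : (1 : ℝ) ≤ n := by exact_mod_cast (by omega : 1 ≤ n)
  have hn0 : (0 : ℝ) < n := by linarith
  have hpow : (n : ℝ) ^ ((3 : ℝ) / 2) = n * √n := by
    rw [show (3 : ℝ) / 2 = 1 + 1 / 2 by norm_num, Real.rpow_add hn0, Real.rpow_one,
      ← Real.sqrt_eq_rpow]
  rw [hpow, add_div]
  refine add_le_add ?_ ?_
  · gcongr
    nlinarith [Real.pi_gt_three]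
  · rw [mul_div_assoc]
    gcongr
    rw [le_div_iff₀ (by positivity)]
    have h1 : √(n : ℝ) ≤ n := Real.sqrt_le_iff.2 ⟨hn0.le, by nlinarith⟩
    have h2 : (n : ℝ) ≤ 25 * ((n / 25 : ℕ) + 1) := by
      exact_mod_cast (by omega : n ≤ 25 * (n / 25 + 1))
    have h3 := hC (n / 25)
    have hp : (0 : ℝ) ≤ (97 / 100) ^ (n / 25) := by positivity
    calc (97 / 100 : ℝ) ^ (n / 25) * (n * √n) ≤ (97 / 100) ^ (n / 25) *
          ((25 * ((n / 25 : ℕ) + 1)) * (25 * ((n / 25 : ℕ) + 1))) := by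
          gcongr
          exact h1.trans h2
      _ = 625 * ((((n / 25 : ℕ) : ℝ) + 1) ^ 2 * (97 / 100) ^ (n / 25)) := by ring
      _ ≤ 625 * C := by gcongr
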